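/- (One-step stationarity; kernel form of Proposition 1.) For every m ≥ 1, M > 0, and α ∈ [0,1], the CRP(M) distribution is stationary for the tRPM transition kernel: for every partition λ of {1, …, m}, Σ_ρ p_m(ρ) K_α(ρ, λ) = p_m(λ), where the sum runs over all partitions ρ of {1, …, m}. -/

import Mathlib

open Finset

noncomputable section

/-- CRP(M) probability of a partition of a finite set `s` of `n = s.card` elements:
`p_n(ρ) = M^k ∏_j (|S_j| - 1)! / ∏_{i=1}^n (M + i - 1)`. -/
def crp {α : Type*} [DecidableEq α] (M : ℝ) {s : Finset α} (P : Finpartition s) : ℝ :=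
  (M ^ P.parts.card * ∏ b ∈ P.parts, (Nat.factorial (b.card - 1) : ℝ)) /
    ∏ i ∈ Finset.range s.card, (M + i)

/-- Restriction of a partition of `s` to a subset `A ⊆ s`: the clusters are the
nonempty intersections of the clusters with `A`. -/
def restrictPart {α : Type*} [DecidableEq α] {s : Finset α} (P : Finpartition s)
    (A : Finset α) (hA : A ⊆ s) : Finpartition A :=
  Finpartition.ofErase (P.parts.image (· ∩ A))
    (by
      rw [Finset.supIndep_iff_pairwiseDisjoint]
      rintro x hx y hy hxy
      simp only [coe_image, Set.mem_image, mem_coe] at hx hy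
      obtain ⟨p, hp, rfl⟩ := hx
      obtain ⟨q, hq, rfl⟩ := hy
      have hpq : p ≠ q := by rintro rfl; exact hxy rfl
      exact (P.disjoint hp hq hpq).mono inter_subset_left inter_subset_left)
    (by
      rw [Finset.sup_image]
      have : (P.parts.sup (id ∘ (· ∩ A))) = P.parts.sup id ⊓ A := by
        rw [Finset.sup_inf_distrib_right]
        rfl
      rw [this, P.sup_parts]
      exact inf_eq_right.mpr hA)

/-- The set `S(γ) = {i : γ i = 1}`. -/
def gammaSet {m : ℕ} (γ : Fin m → Bool) : Finset (Fin m) :=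
  Finset.univ.filter (fun i => γ i = true)

/-- The one-step tRPM transition kernel `K_α(ρ, λ)`. -/
def tK {m : ℕ} (M a : ℝ) (ρ lam : Finpartition (Finset.univ : Finset (Fin m))) : ℝ :=
  ∑ γ : Fin m → Bool,
    (∏ i, if γ i then a else 1 - a) *
      (if restrictPart lam (gammaSet γ) (Finset.subset_univ _) =
          restrictPart ρ (gammaSet γ) (Finset.subset_univ _) then 1 else 0) *
      (crp M lam / crp M (restrictPart lam (gammaSet γ) (Finset.subset_univ _)))

end

theorem mem_restrictPart {α : Type*} [DecidableEq α] {s : Finset α} (P : Finpartition s)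
    (A : Finset α) (hA : A ⊆ s) (c : Finset α) :
    c ∈ (restrictPart P A hA).parts ↔ c ≠ ∅ ∧ ∃ p ∈ P.parts, p ∩ A = c := by
  simp [restrictPart, Finpartition.ofErase]

theorem restrictPart_trans {α : Type*} [DecidableEq α] {s : Finset α} (P : Finpartition s)
    (A B : Finset α) (hA : A ⊆ B) (hB : B ⊆ s) :
    restrictPart (restrictPart P B hB) A hA = restrictPart P A (hA.trans hB) := by
  apply Finpartition.ext
  ext c
  simp only [mem_restrictPart]
  refine and_congr_right fun hc => ?_
  constructor
  · rintro ⟨p, ⟨hp, q, hq, rfl⟩, rfl⟩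
    exact ⟨q, hq, by rw [inter_assoc, inter_eq_right.2 hA]⟩
  · rintro ⟨q, hq, rfl⟩
    have e : q ∩ B ∩ A = q ∩ A := by rw [inter_assoc, inter_eq_right.2 hA]
    refine ⟨q ∩ B, ⟨?_, q, hq, rfl⟩, e⟩
    intro h0
    rw [h0, empty_inter] at e
    exact hc e.symm

theorem restrictPart_self {α : Type*} [DecidableEq α] {s : Finset α} (P : Finpartition s)
    (h : s ⊆ s) : restrictPart P s h = P := by
  apply Finpartition.ext
  ext c
  simp only [mem_restrictPart]
  constructor
  · rintro ⟨_, p, hp, rfl⟩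
    rwa [inter_eq_left.2 (P.subset hp)]
  · intro hc
    exact ⟨P.ne_empty hc, c, hc, inter_eq_left.2 (P.subset hc)⟩

/-- Add `x` to the cluster `b` of `Q` (to a new cluster if `b = ∅`). -/
def addPart {α : Type*} [DecidableEq α] {s : Finset α} (Q : Finpartition s) (x : α) (hx : x ∉ s)
    (b : Finset α) (hb : b ∈ insert ∅ Q.parts) : Finpartition (insert x s) :=
  Finpartition.ofExistsUnique (insert (insert x b) (Q.parts.erase b))
    (by
      intro p hp
      have hbs : b ⊆ s := by
        rcases mem_insert.1 hb with rfl | hb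
        · simp
        · exact Q.subset hb
      rcases mem_insert.1 hp with rfl | hp
      · exact insert_subset_insert _ hbs
      · exact (Q.subset (mem_of_mem_erase hp)).trans (subset_insert _ _))
    (by
      intro y hy
      rcases mem_insert.1 hy with rfl | hys
      · refine ⟨insert y b, by simp, ?_⟩
        rintro t ⟨ht, hyt⟩
        rcases mem_insert.1 ht with rfl | ht
        · rfl
        · exact absurd (Q.subset (mem_of_mem_erase ht) hyt) hx
      · have hyx : y ≠ x := by rintro rfl; exact hx hys
        by_cases hyb : y ∈ b
        · refine ⟨insert x b, by simp [hyb], ?_⟩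
          rintro t ⟨ht, hyt⟩
          rcases mem_insert.1 ht with rfl | ht
          · rfl
          · rcases mem_insert.1 hb with rfl | hb
            · simp at hyb
            · exact absurd (Q.eq_of_mem_parts (mem_of_mem_erase ht) hb hyt hyb) (ne_of_mem_erase ht)
        · obtain ⟨t, ht, hyt⟩ := Q.exists_mem hys
          have htb : t ≠ b := by rintro rfl; exact hyb hyt
          refine ⟨t, ⟨mem_insert_of_mem (mem_erase.2 ⟨htb, ht⟩), hyt⟩, ?_⟩
          rintro u ⟨hu, hyu⟩
          rcases mem_insert.1 hu with rfl | hu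
          · simp [hyx, hyb] at hyu
          · exact Q.eq_of_mem_parts (mem_of_mem_erase hu) ht hyu hyt)
    (by
      intro h
      rcases mem_insert.1 h with h | h
      · exact (insert_ne_empty _ _) h.symm
      · exact Q.empty_notMem_parts (mem_of_mem_erase h))

theorem addPart_parts {α : Type*} [DecidableEq α] {s : Finset α} (Q : Finpartition s) (x : α)
    (hx : x ∉ s) (b : Finset α) (hb : b ∈ insert ∅ Q.parts) :
    (addPart Q x hx b hb).parts = insert (insert x b) (Q.parts.erase b) := rfl

theorem restrictPart_addPart {α : Type*} [DecidableEq α] {s : Finset α} (Q : Finpartition s)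
    (x : α) (hx : x ∉ s) (b : Finset α) (hb : b ∈ insert ∅ Q.parts) :
    restrictPart (addPart Q x hx b hb) s (subset_insert _ _) = Q := by
  apply Finpartition.ext
  ext c
  have hbs : b ⊆ s := by
    rcases mem_insert.1 hb with rfl | hb
    · simp
    · exact Q.subset hb
  have e : insert x b ∩ s = b := by rw [insert_inter_of_notMem hx, inter_eq_left.2 hbs]
  simp only [mem_restrictPart, addPart_parts]
  constructor
  · rintro ⟨hc, p, hp, rfl⟩
    rcases mem_insert.1 hp with rfl | hp
    · rw [e] at hc ⊢
      exact (mem_insert.1 hb).resolve_left hc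
    · have := mem_of_mem_erase hp
      rwa [inter_eq_left.2 (Q.subset this)]
  · intro hc
    refine ⟨Q.ne_empty hc, ?_⟩
    by_cases h : c = b
    · exact ⟨insert x b, by simp, by rw [e, h]⟩
    · exact ⟨c, by simp [h, hc], inter_eq_left.2 (Q.subset hc)⟩

theorem crp_addPart {α : Type*} [DecidableEq α] {s : Finset α} (Q : Finpartition s)
    (x : α) (hx : x ∉ s) (M : ℝ) (hM : 0 < M) (b : Finset α) (hb : b ∈ insert ∅ Q.parts) :
    crp M (addPart Q x hx b hb) =
      crp M Q * ((if b = ∅ then M else (b.card : ℝ)) / (M + s.card)) := by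
  have hbs : b ⊆ s := by
    rcases mem_insert.1 hb with rfl | hb
    · simp
    · exact Q.subset hb
  have hxb : x ∉ b := fun h => hx (hbs h)
  have hn : insert x b ∉ Q.parts.erase b := fun h =>
    hx (Q.subset (mem_of_mem_erase h) (mem_insert_self _ _))
  unfold crp
  rw [addPart_parts, card_insert_of_notMem hn, prod_insert hn, card_insert_of_notMem hx,
    prod_range_succ, card_insert_of_notMem hxb]
  by_cases h : b = ∅
  · subst h
    rw [erase_eq_of_notMem Q.empty_notMem_parts]
    simp only [card_empty, if_true, pow_succ]
    rw [← mul_div_assoc, div_mul_eq_mul_div, div_div]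
    simp
    ring
  · have hbQ := (mem_insert.1 hb).resolve_left h
    rw [← mul_prod_erase Q.parts _ hbQ, card_erase_add_one hbQ, if_neg h]
    obtain ⟨k, hk⟩ : ∃ k, b.card = k + 1 :=
      ⟨b.card - 1, by have := card_pos.2 (nonempty_iff_ne_empty.2 h); omega⟩
    rw [hk]
    simp only [Nat.add_sub_cancel, Nat.factorial_succ]
    push_cast
    rw [← mul_div_assoc, div_mul_eq_mul_div, div_div]
    congr 1
    ring

theorem sum_fiber_insert {α : Type*} [DecidableEq α] {s : Finset α} (Q : Finpartition s)
    (x : α) (hx : x ∉ s) (M : ℝ) (hM : 0 < M) :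
    ∑ P : Finpartition (insert x s),
      (if restrictPart P s (subset_insert _ _) = Q then crp M P else 0) = crp M Q := by
  rw [← sum_filter]
  have key : ∀ P : Finpartition (insert x s), ∀ p ∈ P.parts, x ∉ p → p ∩ s = p := by
    intro P p hp hxp
    exact inter_eq_left.2 ((subset_insert_iff_of_notMem hxp).1 (P.subset hp))
  have hpx : ∀ P : Finpartition (insert x s), insert x (P.part x ∩ s) = P.part x := by
    intro P
    have h1 : x ∈ P.part x := by simp
    have h2 := P.part_subset x
    ext y
    have := @h2 y
    simp only [mem_insert, mem_inter] at this ⊢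
    constructor
    · rintro (rfl | h)
      · exact h1
      · exact h.1
    · intro h
      rcases this h with h' | h'
      · exact Or.inl h'
      · exact Or.inr ⟨h, h'⟩
  have hi : ∀ P : Finpartition (insert x s), restrictPart P s (subset_insert _ _) = Q →
      P.part x ∩ s ∈ insert ∅ Q.parts := by
    rintro P rfl
    by_cases h : P.part x ∩ s = ∅
    · simp [h]
    · exact mem_insert_of_mem ((mem_restrictPart _ _ _ _).2 ⟨h, P.part x, by simp, rfl⟩)
  have main : ∑ P ∈ univ.filter (fun P : Finpartition (insert x s) =>
        restrictPart P s (subset_insert _ _) = Q), crp M P =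
      ∑ b ∈ insert ∅ Q.parts, crp M Q * ((if b = ∅ then M else (b.card : ℝ)) / (M + s.card)) := by
    have hji : ∀ (P : Finpartition (insert x s))
        (hP : restrictPart P s (subset_insert _ _) = Q),
        addPart Q x hx (P.part x ∩ s) (hi P hP) = P := by
      rintro P rfl
      apply Finpartition.ext
      rw [addPart_parts, hpx]
      ext c
      simp only [mem_insert, mem_erase, mem_restrictPart]
      constructor
      · rintro (rfl | ⟨hc, hc0, p, hp, rfl⟩)
        · simp
        · have : x ∉ p := fun h => hc (by rw [P.part_eq_of_mem hp h])
          rwa [key P p hp this]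
      · intro hc
        by_cases h : c = P.part x
        · exact Or.inl h
        · have hxc : x ∉ c := fun h' => h (P.part_eq_of_mem hc h').symm
          refine Or.inr ⟨?_, P.ne_empty hc, c, hc, key P c hc hxc⟩
          intro h'
          obtain ⟨y, hy⟩ := P.nonempty_of_mem_parts hc
          have hy2 : y ∈ P.part x := by
            rw [h'] at hy
            exact (mem_inter.1 hy).1
          exact h (P.eq_of_mem_parts hc (by simp) hy hy2)
    refine sum_bij' (fun P _ => P.part x ∩ s) (fun b hb => addPart Q x hx b hb) ?_ ?_ ?_ ?_ ?_
    · intro P hP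
      exact hi P (mem_filter.1 hP).2
    · intro b hb
      simp [restrictPart_addPart]
    · intro P hP
      exact hji P (mem_filter.1 hP).2
    · intro b hb
      have hbs : b ⊆ s := by
        rcases mem_insert.1 hb with rfl | hb
        · simp
        · exact Q.subset hb
      have : (addPart Q x hx b hb).part x = insert x b :=
        Finpartition.part_eq_of_mem _ (by simp [addPart_parts]) (by simp)
      simp only [this]
      rw [insert_inter_of_notMem hx, inter_eq_left.2 hbs]
    · intro P hP
      have hP' := (mem_filter.1 hP).2
      rw [← crp_addPart Q x hx M hM _ (hi P hP'), hji P hP']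
  rw [main, ← mul_sum, ← sum_div, sum_insert Q.empty_notMem_parts]
  have h2 : ∑ b ∈ Q.parts, (if b = ∅ then M else (b.card : ℝ)) = s.card := by
    rw [← Q.sum_card_parts]
    push_cast
    refine sum_congr rfl fun b hb => ?_
    rw [if_neg (Q.ne_empty hb)]
  rw [h2, if_pos rfl, div_self (by positivity), mul_one]

theorem sum_fiber {α : Type*} [DecidableEq α] (M : ℝ) (hM : 0 < M) (A : Finset α)
    (Q : Finpartition A) (n : ℕ) : ∀ (s : Finset α) (hA : A ⊆ s), s.card = n + A.card →
    ∑ P : Finpartition s, (if restrictPart P A hA = Q then crp M P else 0) = crp M Q := by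
  induction n with
  | zero =>
    intro s hA hs
    obtain rfl : A = s := eq_of_subset_of_card_le hA (by omega)
    simp [restrictPart_self]
  | succ n ih =>
    intro t hA ht
    obtain ⟨x, hxt, hxA⟩ : ∃ x ∈ t, x ∉ A := exists_mem_notMem_of_card_lt_card (by omega)
    obtain ⟨s, hxs, rfl⟩ : ∃ s, x ∉ s ∧ insert x s = t :=
      ⟨t.erase x, by simp, insert_erase hxt⟩
    have hAs : A ⊆ s := (subset_insert_iff_of_notMem hxA).1 hA
    rw [card_insert_of_notMem hxs] at ht
    rw [← ih s hAs (by omega)]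
    have h1 : ∀ R : Finpartition s, (if restrictPart R A hAs = Q then crp M R else 0) =
        ∑ P : Finpartition (insert x s), if restrictPart P s (subset_insert _ _) = R then
          (if restrictPart R A hAs = Q then crp M P else 0) else 0 := by
      intro R
      by_cases h : restrictPart R A hAs = Q
      · simp only [h, if_true]
        exact (sum_fiber_insert R x hxs M hM).symm
      · simp [h]
    rw [sum_congr rfl fun R _ => h1 R, sum_comm]
    refine sum_congr rfl fun P _ => ?_
    rw [sum_ite_eq]
    simp [restrictPart_trans]

theorem crp_pos {α : Type*} [DecidableEq α] (M : ℝ) (hM : 0 < M) {s : Finset α}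
    (P : Finpartition s) : 0 < crp M P := by
  unfold crp
  have : 0 < ∏ b ∈ P.parts, (Nat.factorial (b.card - 1) : ℝ) :=
    prod_pos fun b _ => by exact_mod_cast Nat.factorial_pos _
  have h2 : 0 < ∏ i ∈ Finset.range s.card, (M + i) := prod_pos fun i _ => by positivity
  positivity

/-- one-step stationarity; kernel form of Proposition 1: the CRP(M)
distribution is stationary for the tRPM transition kernel. -/
theorem statement5 (m : ℕ) (hm : 1 ≤ m) (M : ℝ) (hM : 0 < M)
    (a : ℝ) (ha : a ∈ Set.Icc (0 : ℝ) 1)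
    (lam : Finpartition (Finset.univ : Finset (Fin m))) :
    ∑ ρ : Finpartition (Finset.univ : Finset (Fin m)), crp M ρ * tK M a ρ lam =
      crp M lam := by
  have hw : ∑ γ : Fin m → Bool, (∏ i, if γ i then a else 1 - a) = 1 := by
    have := (Finset.prod_univ_sum (fun _ : Fin m => (univ : Finset Bool))
      (fun _ b => if b then a else 1 - a))
    rw [Fintype.piFinset_univ] at this
    rw [← this]
    simp
  unfold tK
  simp only [mul_sum]
  rw [sum_comm]
  have h : ∀ γ : Fin m → Bool, ∑ ρ : Finpartition (Finset.univ : Finset (Fin m)),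
      crp M ρ * ((∏ i, if γ i then a else 1 - a) *
      (if restrictPart lam (gammaSet γ) (Finset.subset_univ _) =
          restrictPart ρ (gammaSet γ) (Finset.subset_univ _) then 1 else 0) *
      (crp M lam / crp M (restrictPart lam (gammaSet γ) (Finset.subset_univ _)))) =
      (∏ i, if γ i then a else 1 - a) * crp M lam := by
    intro γ
    have hle := card_le_card (subset_univ (gammaSet γ))
    have hf := sum_fiber M hM (gammaSet γ)
      (restrictPart lam (gammaSet γ) (Finset.subset_univ _))
      ((univ : Finset (Fin m)).card - (gammaSet γ).card) univ (subset_univ _) (by omega)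
    have hp := crp_pos M hM (restrictPart lam (gammaSet γ) (Finset.subset_univ _))
    set c := crp M (restrictPart lam (gammaSet γ) (Finset.subset_univ _)) with hc
    have : (∏ i, if γ i then a else 1 - a) * crp M lam =
        ((∏ i, if γ i then a else 1 - a) * (crp M lam / c)) * c := by
      field_simp
    rw [this]
    generalize crp M lam / c = d
    conv_rhs => rw [← hf]
    rw [mul_sum]
    refine sum_congr rfl fun ρ _ => ?_
    simp only [eq_comm (a := restrictPart lam (gammaSet γ) (Finset.subset_univ _))]
    split_ifs <;> ring
  rw [sum_congr rfl fun γ _ => h γ, ← sum_mul, hw, one_mul]
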